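/- arXiv:2503.14177 — 7 statements merged into one kernel-verified Lean document; each statement's English description precedes it below -/
import Mathlib

section
/- Let n be a positive integer, let P and Q be n×n real positive definite matrices, let L be a lower-triangular n×n real matrix with positive diagonal entries such that L * Lᵀ = P⁻¹, and let A, F be n×n real matrices satisfying the stochastic Lyapunov equation Aᵀ * P + P * A + Fᵀ * P * F = -Q. Then there exist a skew-symmetric n×n real matrix S and an n×n real matrix F̃ such that A = -(1/2) * P⁻¹ * (Q + F̃ᵀ * F̃ + S) and F = L * F̃. -/
open Matrix

/-- Every stable pair `(A, F)` (i.e. satisfying the stochastic Lyapunov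
equation `Aᵀ P + P A + Fᵀ P F = -Q`) admits the direct parametrization
`A = -(1/2) P⁻¹ (Q + Ftᵀ Ft + S)`, `F = L Ft` where `L` is the lower-triangular
Cholesky factor of `P⁻¹`, `S` is skew-symmetric and `Ft` arbitrary. -/
theorem stable_pair_param {n : ℕ} (hn : 0 < n)
    (P Q : Matrix (Fin n) (Fin n) ℝ) (hP : P.PosDef) (hQ : Q.PosDef)
    (L : Matrix (Fin n) (Fin n) ℝ)
    (hLtri : ∀ i j, i < j → L i j = 0) (hLdiag : ∀ i, 0 < L i i)
    (hL : L * Lᵀ = P⁻¹)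
    (A F : Matrix (Fin n) (Fin n) ℝ)
    (hLyap : Aᵀ * P + P * A + Fᵀ * P * F = -Q) :
    ∃ (S Ft : Matrix (Fin n) (Fin n) ℝ),
      Sᵀ = -S ∧
      A = (-(1/2 : ℝ)) • (P⁻¹ * (Q + Ftᵀ * Ft + S)) ∧
      F = L * Ft := by
  have hdet : IsUnit P.det := hP.det_pos.ne'.isUnit
  have hPt : Pᵀ = P := by
    have h := hP.isHermitian.eq
    rwa [conjTranspose_eq_transpose_of_trivial] at h
  have hinv : P * P⁻¹ = 1 := mul_nonsing_inv P hdet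
  have hinv2 : P⁻¹ * P = 1 := nonsing_inv_mul P hdet
  have hF : (Lᵀ * P * F)ᵀ * (Lᵀ * P * F) = Fᵀ * P * F := by
    calc (Lᵀ * P * F)ᵀ * (Lᵀ * P * F) = Fᵀ * (P * (L * Lᵀ)) * P * F := by
          simp only [transpose_mul, transpose_transpose, hPt, Matrix.mul_assoc]
      _ = Fᵀ * P * F := by rw [hL, hinv, Matrix.mul_one]
  refine ⟨Aᵀ * P - P * A, Lᵀ * P * F, ?_, ?_, ?_⟩
  · simp only [transpose_sub, transpose_mul, transpose_transpose, hPt, neg_sub]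
  · have hQ' : Q = -(Aᵀ * P + P * A + Fᵀ * P * F) := by rw [hLyap, neg_neg]
    have hsum : Q + Fᵀ * P * F + (Aᵀ * P - P * A) = (-2 : ℝ) • (P * A) := by
      rw [hQ']
      module
    rw [hF, hsum, Matrix.mul_smul, ← Matrix.mul_assoc, hinv2, Matrix.one_mul, smul_smul]
    norm_num
  · rw [← Matrix.mul_assoc, ← Matrix.mul_assoc, hL, hinv2, Matrix.one_mul]
end

section
/- Let n be a positive integer, let P and Q be n×n real positive definite matrices, let L be a lower-triangular n×n real matrix with positive diagonal entries such that L * Lᵀ = P⁻¹, let S be a skew-symmetric n×n real matrix, and let F̃ be an arbitrary n×n real matrix. Define A := -(1/2) * P⁻¹ * (Q + F̃ᵀ * F̃ + S) and F := L * F̃. Then Aᵀ * P + P * A + Fᵀ * P * F = -Q. -/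
open Matrix

/-- Converse of the direct parametrization: for any positive definite
`P, Q`, skew-symmetric `S`, arbitrary `Ft`, and lower-triangular Cholesky factor `L`
of `P⁻¹`, the matrices `A = -(1/2) P⁻¹ (Q + Ftᵀ Ft + S)` and `F = L Ft` satisfy the
stochastic Lyapunov equation `Aᵀ P + P A + Fᵀ P F = -Q`. -/
theorem stable_pair_param_converse {n : ℕ} (hn : 0 < n)
    (P Q : Matrix (Fin n) (Fin n) ℝ) (hP : P.PosDef) (hQ : Q.PosDef)
    (L : Matrix (Fin n) (Fin n) ℝ)
    (hLtri : ∀ i j, i < j → L i j = 0) (hLdiag : ∀ i, 0 < L i i)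
    (hL : L * Lᵀ = P⁻¹)
    (S : Matrix (Fin n) (Fin n) ℝ) (hS : Sᵀ = -S)
    (Ft : Matrix (Fin n) (Fin n) ℝ)
    (A F : Matrix (Fin n) (Fin n) ℝ)
    (hA : A = (-(1/2 : ℝ)) • (P⁻¹ * (Q + Ftᵀ * Ft + S)))
    (hF : F = L * Ft) :
    Aᵀ * P + P * A + Fᵀ * P * F = -Q := by
  have hPt : Pᵀ = P := by simpa using hP.isHermitian.eq
  have hQt : Qᵀ = Q := by simpa using hQ.isHermitian.eq
  have hdet : IsUnit P.det := isUnit_iff_ne_zero.mpr (ne_of_gt hP.det_pos)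
  have h1 : Lᵀ * P * L = 1 := by
    apply mul_eq_one_comm.mp
    rw [← Matrix.mul_assoc, hL, Matrix.nonsing_inv_mul _ hdet]
  have hPA : P * A = (-(1/2 : ℝ)) • (Q + Ftᵀ * Ft + S) := by
    rw [hA, Matrix.mul_smul, Matrix.mul_nonsing_inv_cancel_left _ _ hdet]
  have hAP : Aᵀ * P = (-(1/2 : ℝ)) • (Q + Ftᵀ * Ft - S) := by
    have h2 : Aᵀ * P = (P * A)ᵀ := by rw [Matrix.transpose_mul, hPt]
    rw [h2, hPA]
    simp [Matrix.transpose_add, Matrix.transpose_mul, hQt, hS, sub_eq_add_neg]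
  have hFF : Fᵀ * P * F = Ftᵀ * Ft := by
    have h3 : Fᵀ * P * F = Ftᵀ * (Lᵀ * P * L) * Ft := by
      rw [hF, Matrix.transpose_mul]
      simp only [Matrix.mul_assoc]
    rw [h3, h1, Matrix.mul_one]
  rw [hPA, hAP, hFF]
  module
end

section
/- Let n be a positive integer, let P and Q be n×n real positive definite matrices, let S be a skew-symmetric n×n real matrix, let F̃ be an n×n real matrix, and define A := -(1/2) * P⁻¹ * (Q + F̃ᵀ * F̃ + S). Then every complex eigenvalue λ of A (i.e., every λ ∈ ℂ for which there exists a nonzero v ∈ ℂⁿ with A v = λ v, where A acts via the entrywise embedding of ℝ into ℂ) has strictly negative real part; in particular A is a Hurwitz matrix. -/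
open Matrix

/-- The quadratic form of `Q + Ftᵀ Ft + S` is positive. -/
lemma quad_pos {n : ℕ} (Q S Ft : Matrix (Fin n) (Fin n) ℝ) (hQ : Q.PosDef) (hS : Sᵀ = -S)
    (x : Fin n → ℝ) (hx : x ≠ 0) : 0 < x ⬝ᵥ ((Q + Ftᵀ * Ft + S) *ᵥ x) := by
  have h1 : 0 < x ⬝ᵥ (Q *ᵥ x) := by simpa using hQ.dotProduct_mulVec_pos hx
  have h2 : 0 ≤ x ⬝ᵥ ((Ftᵀ * Ft) *ᵥ x) := by
    rw [← mulVec_mulVec, dotProduct_mulVec, vecMul_transpose]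
    exact Finset.sum_nonneg fun i _ => mul_self_nonneg _
  have h3 : x ⬝ᵥ (S *ᵥ x) = 0 := by
    have h : x ⬝ᵥ (S *ᵥ x) = - (x ⬝ᵥ (S *ᵥ x)) := by
      conv_lhs => rw [dotProduct_mulVec, ← mulVec_transpose, hS, dotProduct_comm]
      rw [neg_mulVec, dotProduct_neg]
    linarith
  rw [add_mulVec, add_mulVec, dotProduct_add, dotProduct_add]
  linarith

lemma quad_nonneg_of_pos {n : ℕ} (M : Matrix (Fin n) (Fin n) ℝ)
    (h : ∀ x : Fin n → ℝ, x ≠ 0 → 0 < x ⬝ᵥ (M *ᵥ x)) (x y : Fin n → ℝ)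
    (hxy : x ≠ 0 ∨ y ≠ 0) : 0 < x ⬝ᵥ (M *ᵥ x) + y ⬝ᵥ (M *ᵥ y) := by
  have h0 : ∀ x : Fin n → ℝ, 0 ≤ x ⬝ᵥ (M *ᵥ x) := by
    intro x
    by_cases hx : x = 0
    · simp [hx]
    · exact (h x hx).le
  rcases hxy with hx | hy
  · linarith [h x hx, h0 y]
  · linarith [h y hy, h0 x]

/-- The matrix `A = -(1/2) P⁻¹ (Q + Ftᵀ Ft + S)` with `P, Q` positive
definite, `S` skew-symmetric and `Ft` arbitrary is Hurwitz: every complex eigenvalue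
has strictly negative real part. -/
theorem param_is_hurwitz {n : ℕ} (hn : 0 < n)
    (P Q : Matrix (Fin n) (Fin n) ℝ) (hP : P.PosDef) (hQ : Q.PosDef)
    (S : Matrix (Fin n) (Fin n) ℝ) (hS : Sᵀ = -S)
    (Ft : Matrix (Fin n) (Fin n) ℝ)
    (A : Matrix (Fin n) (Fin n) ℝ)
    (hA : A = (-(1/2 : ℝ)) • (P⁻¹ * (Q + Ftᵀ * Ft + S))) :
    ∀ (μ : ℂ) (v : Fin n → ℂ), v ≠ 0 →
      (A.map (Complex.ofReal)) *ᵥ v = μ • v → μ.re < 0 := by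
  intro μ v hv hAv
  set x : Fin n → ℝ := fun i => (v i).re with hx
  set y : Fin n → ℝ := fun i => (v i).im with hy
  have hxy : x ≠ 0 ∨ y ≠ 0 := by
    by_contra! hc
    apply hv
    funext i
    exact Complex.ext (congrFun hc.1 i) (congrFun hc.2 i)
  have hAx : A *ᵥ x = μ.re • x - μ.im • y := by
    funext i
    have := congrArg Complex.re (congrFun hAv i)
    simpa [mulVec, dotProduct, hx, hy] using this
  have hAy : A *ᵥ y = μ.re • y + μ.im • x := by
    funext i
    have := congrArg Complex.im (congrFun hAv i)
    simpa [mulVec, dotProduct, hx, hy] using this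
  have hPA : P * A = (-(1/2 : ℝ)) • (Q + Ftᵀ * Ft + S) := by
    rw [hA, mul_smul_comm, mul_nonsing_inv_cancel_left _ _
      ((isUnit_iff_isUnit_det _).1 hP.isUnit)]
  have hM := quad_nonneg_of_pos _ (quad_pos Q S Ft hQ hS) x y hxy
  have hPP := quad_nonneg_of_pos P
    (fun z hz => by simpa using hP.dotProduct_mulVec_pos hz) x y hxy
  have hPt : Pᵀ = P := by simpa using hP.isHermitian.eq
  have hsym : x ⬝ᵥ (P *ᵥ y) = y ⬝ᵥ (P *ᵥ x) := by
    rw [dotProduct_mulVec, ← mulVec_transpose, hPt, dotProduct_comm]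
  have key : ∀ z, P *ᵥ (A *ᵥ z) = (-(1/2 : ℝ)) • ((Q + Ftᵀ * Ft + S) *ᵥ z) := by
    intro z
    rw [mulVec_mulVec, hPA, smul_mulVec]
  have e1 := congrArg (x ⬝ᵥ ·) (key x)
  have e2 := congrArg (y ⬝ᵥ ·) (key y)
  simp only [hAx, hAy, mulVec_sub, mulVec_smul, dotProduct_sub, dotProduct_smul,
    smul_eq_mul] at e1 e2
  rw [mulVec_add, dotProduct_add, mulVec_smul, mulVec_smul, dotProduct_smul, dotProduct_smul,
    smul_eq_mul, smul_eq_mul] at e2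
  rw [hsym] at e1
  by_contra! hc
  nlinarith [mul_nonneg hc hPP.le]
end

section
/- Let n be a positive integer, let P and Q be n×n real positive definite matrices, let S be a skew-symmetric n×n real matrix, let F̃ be an n×n real matrix, and define A := -(1/2) * P⁻¹ * (Q + F̃ᵀ * F̃ + S). If λ ∈ ℂ and v ∈ ℂⁿ with v ≠ 0 satisfy A v = λ v (with A acting via the entrywise embedding of ℝ into ℂ), then the quantity v† S v is purely imaginary (its real part is zero), the quantity v† P v is real and strictly positive, and the imaginary part of λ equals -Im(v† S v) / (2 · Re(v† P v)). -/
open Matrix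

lemma aux_star {n : ℕ} (M : Matrix (Fin n) (Fin n) ℝ) (v : Fin n → ℂ) :
    (starRingEnd ℂ) (star v ⬝ᵥ ((M.map (Complex.ofReal)) *ᵥ v)) =
      star v ⬝ᵥ ((Mᵀ.map (Complex.ofReal)) *ᵥ v) := by
  simp only [dotProduct, mulVec, Finset.mul_sum, map_sum, map_mul]
  rw [Finset.sum_comm]
  refine Finset.sum_congr rfl fun i _ => Finset.sum_congr rfl fun j _ => ?_
  simp
  ring

lemma aux_re {n : ℕ} (M : Matrix (Fin n) (Fin n) ℝ) (v : Fin n → ℂ) :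
    (star v ⬝ᵥ ((M.map (Complex.ofReal)) *ᵥ v)).re =
      (fun i => (v i).re) ⬝ᵥ (M *ᵥ (fun i => (v i).re)) +
      (fun i => (v i).im) ⬝ᵥ (M *ᵥ (fun i => (v i).im)) := by
  simp only [dotProduct, mulVec, Finset.mul_sum, Complex.re_sum, ← Finset.sum_add_distrib]
  refine Finset.sum_congr rfl fun i _ => Finset.sum_congr rfl fun j _ => ?_
  simp

lemma aux_im_symm {n : ℕ} (M : Matrix (Fin n) (Fin n) ℝ) (hM : Mᵀ = M) (v : Fin n → ℂ) :
    (star v ⬝ᵥ ((M.map (Complex.ofReal)) *ᵥ v)).im = 0 := by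
  have h := aux_star M v
  rw [hM] at h
  exact Complex.conj_eq_iff_im.mp h

lemma aux_pos {n : ℕ} (P : Matrix (Fin n) (Fin n) ℝ) (hP : P.PosDef) (v : Fin n → ℂ)
    (hv : v ≠ 0) : 0 < (star v ⬝ᵥ ((P.map (Complex.ofReal)) *ᵥ v)).re := by
  rw [aux_re]
  have h0 : ∀ x : Fin n → ℝ, 0 ≤ x ⬝ᵥ (P *ᵥ x) := fun x => by
    simpa using hP.posSemidef.dotProduct_mulVec_nonneg x
  have h1 : ∀ x : Fin n → ℝ, x ≠ 0 → 0 < x ⬝ᵥ (P *ᵥ x) := fun x hx => by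
    simpa using hP.dotProduct_mulVec_pos hx
  by_cases hr : (fun i => (v i).re) = 0
  · have hi : (fun i => (v i).im) ≠ 0 := fun hi => hv <| by
      funext i
      exact Complex.ext (congrFun hr i) (congrFun hi i)
    exact add_pos_of_nonneg_of_pos (h0 _) (h1 _ hi)
  · exact add_pos_of_pos_of_nonneg (h1 _ hr) (h0 _)


/-- For `A = -(1/2) P⁻¹ (Q + Ftᵀ Ft + S)` and a complex eigenpair
`A v = μ v`, `v ≠ 0`: the quantity `v† S v` is purely imaginary, `v† P v` is real
and strictly positive, and `Im μ = -Im(v† S v) / (2 Re(v† P v))`. -/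
theorem eigenvalue_imaginary_part {n : ℕ} (hn : 0 < n)
    (P Q : Matrix (Fin n) (Fin n) ℝ) (hP : P.PosDef) (hQ : Q.PosDef)
    (S : Matrix (Fin n) (Fin n) ℝ) (hS : Sᵀ = -S)
    (Ft : Matrix (Fin n) (Fin n) ℝ)
    (A : Matrix (Fin n) (Fin n) ℝ)
    (hA : A = (-(1/2 : ℝ)) • (P⁻¹ * (Q + Ftᵀ * Ft + S)))
    (μ : ℂ) (v : Fin n → ℂ) (hv : v ≠ 0)
    (heig : (A.map (Complex.ofReal)) *ᵥ v = μ • v) :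
    (star v ⬝ᵥ ((S.map (Complex.ofReal)) *ᵥ v)).re = 0 ∧
    (star v ⬝ᵥ ((P.map (Complex.ofReal)) *ᵥ v)).im = 0 ∧
    0 < (star v ⬝ᵥ ((P.map (Complex.ofReal)) *ᵥ v)).re ∧
    μ.im = -(star v ⬝ᵥ ((S.map (Complex.ofReal)) *ᵥ v)).im /
      (2 * (star v ⬝ᵥ ((P.map (Complex.ofReal)) *ᵥ v)).re) := by
  have hPs : Pᵀ = P := by simpa using hP.isHermitian.eq
  have hQs : Qᵀ = Q := by simpa using hQ.isHermitian.eq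
  have hSre : (star v ⬝ᵥ ((S.map (Complex.ofReal)) *ᵥ v)).re = 0 := by
    have h := congrArg Complex.re (aux_star S v)
    rw [hS, aux_re (-S), Complex.conj_re, aux_re] at h
    simp only [neg_mulVec, dotProduct_neg] at h
    rw [aux_re]
    linarith
  have hPim := aux_im_symm P hPs v
  have hpos := aux_pos P hP v hv
  refine ⟨hSre, hPim, hpos, ?_⟩
  have hsym := aux_im_symm (Q + Ftᵀ * Ft) (by simp [hQs]) v
  have hPA : (-2 : ℝ) • (P * A) = (Q + Ftᵀ * Ft) + S := by
    have : P * P⁻¹ = 1 := Matrix.mul_nonsing_inv P ((isUnit_iff_isUnit_det P).mp hP.isUnit)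
    rw [hA, Matrix.mul_smul, ← Matrix.mul_assoc, this, Matrix.one_mul, smul_smul]
    norm_num
  have hC : (-2 : ℂ) • (P.map Complex.ofReal * A.map Complex.ofReal) =
      (Q + Ftᵀ * Ft).map Complex.ofReal + S.map Complex.ofReal := by
    have h := congrArg (fun M : Matrix (Fin n) (Fin n) ℝ => M.map Complex.ofReal) hPA
    ext i j
    have h' := congrFun (congrFun h i) j
    simpa [Matrix.mul_apply] using h'
  have hq := congrArg (fun M => star v ⬝ᵥ (M *ᵥ v)) hC
  simp only [smul_mulVec, ← mulVec_mulVec, heig, mulVec_smul, dotProduct_smul, add_mulVec,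
    dotProduct_add, smul_eq_mul] at hq
  have him := congrArg Complex.im hq
  simp only [Complex.add_im, hsym, Complex.mul_im, hPim] at him
  norm_num at him
  rw [eq_div_iff (by positivity)]
  linarith
end

section
/- Let n be a positive integer, let P be an n×n real positive definite matrix, let α > 0 be a real number, let S be a skew-symmetric n×n real matrix, let F̃ be an n×n real matrix, and define A := -(1/2) * P⁻¹ * (α • P + F̃ᵀ * F̃ + S). Then every complex eigenvalue λ of A (i.e., every λ ∈ ℂ for which there exists a nonzero v ∈ ℂⁿ with A v = λ v, where A acts via the entrywise embedding of ℝ into ℂ) satisfies Re(λ) ≤ -α/2. -/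
open Matrix

lemma quad_bound {n : ℕ}
    (P : Matrix (Fin n) (Fin n) ℝ) (hP : P.PosDef) (α : ℝ)
    (S : Matrix (Fin n) (Fin n) ℝ) (hS : Sᵀ = -S)
    (Ft : Matrix (Fin n) (Fin n) ℝ)
    (A : Matrix (Fin n) (Fin n) ℝ)
    (hA : A = (-(1/2 : ℝ)) • (P⁻¹ * (α • P + Ftᵀ * Ft + S))) (w : Fin n → ℝ) :
    w ⬝ᵥ (P *ᵥ (A *ᵥ w)) ≤ -α / 2 * (w ⬝ᵥ (P *ᵥ w)) := by
  have hu : IsUnit P.det := hP.det_pos.ne'.isUnit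
  have hPA : P * A = (-(1/2 : ℝ)) • (α • P + Ftᵀ * Ft + S) := by
    rw [hA, Matrix.mul_smul, Matrix.mul_nonsing_inv_cancel_left _ _ hu]
  have hS0 : w ⬝ᵥ (S *ᵥ w) = 0 := by
    have h : w ⬝ᵥ (S *ᵥ w) = w ⬝ᵥ (Sᵀ *ᵥ w) := by
      rw [Matrix.mulVec_transpose, Matrix.dotProduct_mulVec, dotProduct_comm]
    rw [hS, Matrix.neg_mulVec, dotProduct_neg] at h
    linarith
  have hF : w ⬝ᵥ ((Ftᵀ * Ft) *ᵥ w) = (Ft *ᵥ w) ⬝ᵥ (Ft *ᵥ w) := by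
    rw [← Matrix.mulVec_mulVec, Matrix.dotProduct_mulVec, Matrix.vecMul_transpose]
  have hF0 : 0 ≤ (Ft *ᵥ w) ⬝ᵥ (Ft *ᵥ w) :=
    Finset.sum_nonneg fun i _ => mul_self_nonneg _
  rw [Matrix.mulVec_mulVec, hPA]
  simp only [Matrix.smul_mulVec, Matrix.add_mulVec, dotProduct_smul, dotProduct_add, hS0, hF,
    smul_eq_mul]
  linarith

/-- With `Q = α • P` (decay-rate parametrization), every complex
eigenvalue of `A = -(1/2) P⁻¹ (α P + Ftᵀ Ft + S)` satisfies `Re μ ≤ -α/2`. -/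
theorem eigenvalue_decay_rate {n : ℕ} (hn : 0 < n)
    (P : Matrix (Fin n) (Fin n) ℝ) (hP : P.PosDef)
    (α : ℝ) (hα : 0 < α)
    (S : Matrix (Fin n) (Fin n) ℝ) (hS : Sᵀ = -S)
    (Ft : Matrix (Fin n) (Fin n) ℝ)
    (A : Matrix (Fin n) (Fin n) ℝ)
    (hA : A = (-(1/2 : ℝ)) • (P⁻¹ * (α • P + Ftᵀ * Ft + S))) :
    ∀ (μ : ℂ) (v : Fin n → ℂ), v ≠ 0 →
      (A.map (Complex.ofReal)) *ᵥ v = μ • v → μ.re ≤ -α / 2 := by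
  intro μ v hv h
  let x : Fin n → ℝ := fun i => (v i).re
  let y : Fin n → ℝ := fun i => (v i).im
  have hx : A *ᵥ x = μ.re • x - μ.im • y := by
    ext i
    have := congrArg Complex.re (congrFun h i)
    simpa [Matrix.mulVec, dotProduct, x, y] using this
  have hy : A *ᵥ y = μ.re • y + μ.im • x := by
    ext i
    have := congrArg Complex.im (congrFun h i)
    simpa [Matrix.mulVec, dotProduct, x, y] using this
  have hPt : Pᵀ = P := by simpa using hP.isHermitian.eq
  have hxy : y ⬝ᵥ (P *ᵥ x) = x ⬝ᵥ (P *ᵥ y) := by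
    rw [Matrix.dotProduct_mulVec, ← Matrix.mulVec_transpose, hPt, dotProduct_comm]
  have bx := quad_bound P hP α S hS Ft A hA x
  have bY := quad_bound P hP α S hS Ft A hA y
  rw [hx] at bx
  rw [hy] at bY
  simp only [Matrix.mulVec_sub, Matrix.mulVec_add, Matrix.mulVec_smul, dotProduct_sub,
    dotProduct_add, dotProduct_smul, smul_eq_mul, hxy] at bx bY
  have nn : ∀ w : Fin n → ℝ, 0 ≤ w ⬝ᵥ (P *ᵥ w) := fun w => by
    simpa using hP.posSemidef.dotProduct_mulVec_nonneg w
  have pp : ∀ w : Fin n → ℝ, w ≠ 0 → 0 < w ⬝ᵥ (P *ᵥ w) := fun w hw => by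
    simpa using hP.dotProduct_mulVec_pos hw
  have hpos : 0 < x ⬝ᵥ (P *ᵥ x) + y ⬝ᵥ (P *ᵥ y) := by
    by_cases h0 : x = 0
    · have hy0 : y ≠ 0 := by
        intro h1
        apply hv
        ext i
        exact Complex.ext (congrFun h0 i) (congrFun h1 i)
      linarith [nn x, pp y hy0]
    · linarith [nn y, pp x h0]
  refine le_of_mul_le_mul_right ?_ hpos
  linarith
end

section
/- Let n, ℓ, q be positive integers, let γ > 0 and ρ ∈ [-1, 1] be real numbers, let P be an n×n real positive definite matrix, and let A, F ∈ ℝ^{n×n}, B, G ∈ ℝ^{n×ℓ}, C ∈ ℝ^{q×n}, D ∈ ℝ^{q×ℓ}. Define the symmetric block matrix M := fromBlocks M₁₁ M₁₂ M₁₂ᵀ M₂₂ with M₁₁ = P*A + Aᵀ*P + Fᵀ*P*F + Cᵀ*C, M₁₂ = P*B + ρ • (Fᵀ*P*G) + Cᵀ*D, and M₂₂ = Dᵀ*D - γ² • I + Gᵀ*P*G. If M is negative definite (i.e., -M is positive definite), then there exist an n×n real positive definite matrix Q, a skew-symmetric n×n real matrix S, matrices F̃ ∈ ℝ^{n×n}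 and B̃, G̃ ∈ ℝ^{n×ℓ}, and lower-triangular matrices L_{P⁻¹} and L_Q with positive diagonals satisfying L_{P⁻¹} * L_{P⁻¹}ᵀ = P⁻¹ and L_Q * L_Qᵀ = Q, such that A = -(1/2) * P⁻¹ * (Q + F̃ᵀ*F̃ + Cᵀ*C + S), F = L_{P⁻¹} * F̃, G = L_{P⁻¹} * G̃, B = P⁻¹ * (L_Q * B̃ - ρ • (F̃ᵀ * G̃) - Cᵀ*D), and the matrix γ² • I - (B̃ᵀ*B̃ + Dᵀ*D + G̃ᵀ*G̃) is positive definite. -/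
open Matrix

/-- Existence of the Cholesky factor. -/
theorem exists_cholesky {n : ℕ} (X : Matrix (Fin n) (Fin n) ℝ) (hX : X.PosDef) :
    ∃ L : Matrix (Fin n) (Fin n) ℝ, (∀ i j, i < j → L i j = 0) ∧ (∀ i, 0 < L i i) ∧
      L * Lᵀ = X := by
  classical
  set T := LDL.lower hX with hT
  set d := LDL.diagEntries hX with hd
  have hunit : IsUnit (LDL.lowerInv hX) := isUnit_of_invertible _
  have htri : T.BlockTriangular OrderDual.toDual := by
    rw [hT, LDL.lower]
    apply blockTriangular_inv_of_blockTriangular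
    intro i j hij
    exact LDL.lowerInv_triangular hX hij
  have hTdet : T.det ≠ 0 := by
    have h : IsUnit T := by
      rw [hT, LDL.lower]
      exact (Matrix.isUnit_nonsing_inv_iff).2 hunit
    exact ((Matrix.isUnit_iff_isUnit_det _).1 h).ne_zero
  have hTd : ∀ i, T i i ≠ 0 := by
    rw [det_of_isLowerTriangular T htri] at hTdet
    intro i
    exact Finset.prod_ne_zero_iff.1 hTdet i (Finset.mem_univ i)
  have hdpos : ∀ i, 0 < d i := by
    have h : (diagonal d).PosDef := by
      have h1 := hX.mul_mul_conjTranspose_same (B := LDL.lowerInv hX)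
        (vecMul_injective_of_isUnit hunit)
      rw [← LDL.diag_eq_lowerInv_conj hX] at h1
      exact h1
    exact posDef_diagonal_iff.1 h
  have hfac : T * diagonal d * Tᵀ = X := by
    have := LDL.lower_conj_diag hX
    rwa [conjTranspose_eq_transpose_of_trivial] at this
  set e : Fin n → ℝ := fun i => if 0 < T i i then √(d i) else -√(d i) with he
  have hee : ∀ i, e i * e i = d i := by
    intro i
    have := Real.mul_self_sqrt (hdpos i).le
    simp only [he]
    split_ifs <;> simp [this]
  refine ⟨T * diagonal e, ?_, ?_, ?_⟩
  · intro i j hij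
    rw [mul_diagonal, htri (show OrderDual.toDual j < OrderDual.toDual i from hij), zero_mul]
  · intro i
    rw [mul_diagonal]
    have hs := Real.sqrt_pos.2 (hdpos i)
    simp only [he]
    split_ifs with h
    · exact mul_pos h hs
    · have : T i i < 0 := lt_of_le_of_ne (not_lt.1 h) (hTd i)
      nlinarith
  · rw [transpose_mul, diagonal_transpose, Matrix.mul_assoc, ← Matrix.mul_assoc (diagonal e),
      diagonal_mul_diagonal]
    simp only [hee]
    rw [← Matrix.mul_assoc, hfac]

theorem schur_aux {n l : ℕ} (Q L : Matrix (Fin n) (Fin n) ℝ) (Y W V : Matrix (Fin n) (Fin l) ℝ)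
    (Z : Matrix (Fin l) (Fin l) ℝ) (hL : L * Lᵀ = Q) (hY : L * V = Y) (hW : Lᵀ * W = V)
    (h : (-(fromBlocks (-Q) Y Yᵀ Z)).PosDef) : (-Z - Vᵀ * V).PosDef := by
  have hinj : Function.Injective (fromRows W (1 : Matrix (Fin l) (Fin l) ℝ)).mulVec := by
    intro x y hxy
    simp only [fromRows_mulVec, one_mulVec] at hxy
    funext i
    simpa using congrFun hxy (Sum.inr i)
  have h1 := h.conjTranspose_mul_mul_same hinj
  rw [conjTranspose_eq_transpose_of_trivial, Matrix.mul_assoc, fromBlocks_neg,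
    fromBlocks_mul_fromRows, transpose_fromRows, fromCols_mul_fromRows] at h1
  convert h1 using 1
  have h2 : Q * W = Y := by rw [← hL, Matrix.mul_assoc, hW, hY]
  have h3 : Yᵀ * W = Vᵀ * V := by rw [← hY, transpose_mul, Matrix.mul_assoc, hW]
  simp only [neg_neg, Matrix.neg_mul, Matrix.mul_one, transpose_one, Matrix.one_mul, h2, h3]
  simp
  abel

/-- If the stochastic bounded-real LMI `M < 0` holds, then the SSM
matrices `A, B, C, D, F, G` admit the direct parametrization of Proposition 3, with
a positive definite slack matrix `Q`, skew-symmetric `S`, free matrices `Ft, Bt, Gt`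
satisfying `Btᵀ Bt + Dᵀ D + Gtᵀ Gt < γ² I`, and lower-triangular Cholesky factors of
`P⁻¹` and `Q`. -/
theorem brl_param {n ℓ q : ℕ} (hn : 0 < n) (hℓ : 0 < ℓ) (hq : 0 < q)
    (γ ρ : ℝ) (hγ : 0 < γ) (hρ : ρ ∈ Set.Icc (-1 : ℝ) 1)
    (P : Matrix (Fin n) (Fin n) ℝ) (hP : P.PosDef)
    (A F : Matrix (Fin n) (Fin n) ℝ)
    (B G : Matrix (Fin n) (Fin ℓ) ℝ)
    (C : Matrix (Fin q) (Fin n) ℝ)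
    (D : Matrix (Fin q) (Fin ℓ) ℝ)
    (M₁₁ : Matrix (Fin n) (Fin n) ℝ)
    (M₁₂ : Matrix (Fin n) (Fin ℓ) ℝ)
    (M₂₂ : Matrix (Fin ℓ) (Fin ℓ) ℝ)
    (hM₁₁ : M₁₁ = P * A + Aᵀ * P + Fᵀ * P * F + Cᵀ * C)
    (hM₁₂ : M₁₂ = P * B + ρ • (Fᵀ * P * G) + Cᵀ * D)
    (hM₂₂ : M₂₂ = Dᵀ * D - γ ^ 2 • (1 : Matrix (Fin ℓ) (Fin ℓ) ℝ) + Gᵀ * P * G)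
    (hM : (-(fromBlocks M₁₁ M₁₂ M₁₂ᵀ M₂₂)).PosDef) :
    ∃ (Q : Matrix (Fin n) (Fin n) ℝ) (S : Matrix (Fin n) (Fin n) ℝ)
      (Ft : Matrix (Fin n) (Fin n) ℝ) (Bt Gt : Matrix (Fin n) (Fin ℓ) ℝ)
      (LPinv LQ : Matrix (Fin n) (Fin n) ℝ),
      Q.PosDef ∧ Sᵀ = -S ∧
      (∀ i j, i < j → LPinv i j = 0) ∧ (∀ i, 0 < LPinv i i) ∧
      LPinv * LPinvᵀ = P⁻¹ ∧
      (∀ i j, i < j → LQ i j = 0) ∧ (∀ i, 0 < LQ i i) ∧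
      LQ * LQᵀ = Q ∧
      A = (-(1/2 : ℝ)) • (P⁻¹ * (Q + Ftᵀ * Ft + Cᵀ * C + S)) ∧
      F = LPinv * Ft ∧
      G = LPinv * Gt ∧
      B = P⁻¹ * (LQ * Bt - ρ • (Ftᵀ * Gt) - Cᵀ * D) ∧
      (γ ^ 2 • (1 : Matrix (Fin ℓ) (Fin ℓ) ℝ) - (Btᵀ * Bt + Dᵀ * D + Gtᵀ * Gt)).PosDef := by

  obtain ⟨K, hK0, hKp, hK⟩ := exists_cholesky P⁻¹ hP.inv
  have hPdet : IsUnit P.det := (Matrix.isUnit_iff_isUnit_det _).1 hP.isUnit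
  have hPT : Pᵀ = P := by
    have := hP.isHermitian.eq
    rwa [conjTranspose_eq_transpose_of_trivial] at this
  have hQ : (-M₁₁).PosDef := by
    have hinj : Function.Injective
        (fromRows (1 : Matrix (Fin n) (Fin n) ℝ) (0 : Matrix (Fin ℓ) (Fin n) ℝ)).mulVec := by
      intro x y hxy
      simp only [fromRows_mulVec, one_mulVec] at hxy
      funext i
      simpa using congrFun hxy (Sum.inl i)
    have h1 := hM.conjTranspose_mul_mul_same hinj
    rw [conjTranspose_eq_transpose_of_trivial, Matrix.mul_assoc, fromBlocks_neg,
      fromBlocks_mul_fromRows, transpose_fromRows, fromCols_mul_fromRows] at h1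
    simpa using h1
  obtain ⟨L, hL0, hLp, hL⟩ := exists_cholesky (-M₁₁) hQ
  have hLdet : IsUnit L.det := by
    have h : IsUnit (L * Lᵀ).det := by
      rw [hL]; exact (Matrix.isUnit_iff_isUnit_det _).1 hQ.isUnit
    rw [det_mul] at h
    exact isUnit_of_mul_isUnit_left h
  have hKdet : IsUnit K.det := by
    have h : IsUnit (K * Kᵀ).det := by
      rw [hK]; exact (Matrix.isUnit_iff_isUnit_det _).1 hP.inv.isUnit
    rw [det_mul] at h
    exact isUnit_of_mul_isUnit_left h
  have hKP : (K⁻¹)ᵀ * K⁻¹ = P := by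
    rw [transpose_nonsing_inv, ← Matrix.mul_inv_rev, hK, nonsing_inv_nonsing_inv _ hPdet]
  have key : ∀ {a b : ℕ} (X : Matrix (Fin n) (Fin a) ℝ) (Y : Matrix (Fin n) (Fin b) ℝ),
      (K⁻¹ * X)ᵀ * (K⁻¹ * Y) = Xᵀ * P * Y := by
    intro a b X Y
    rw [transpose_mul, ← hKP]
    simp only [Matrix.mul_assoc]
  refine ⟨-M₁₁, Aᵀ * P - P * A, K⁻¹ * F, L⁻¹ * M₁₂, K⁻¹ * G, K, L, hQ, ?_, hK0, hKp, hK,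
    hL0, hLp, hL, ?_, ?_, ?_, ?_, ?_⟩
  · simp [transpose_sub, transpose_mul, hPT]
  · rw [key, hM₁₁]
    have : -(P * A + Aᵀ * P + Fᵀ * P * F + Cᵀ * C) + Fᵀ * P * F + Cᵀ * C + (Aᵀ * P - P * A)
        = (-2 : ℝ) • (P * A) := by
      rw [neg_smul, two_smul]; abel
    rw [this, Matrix.mul_smul, nonsing_inv_mul_cancel_left _ _ hPdet, smul_smul]
    norm_num
  · rw [mul_nonsing_inv_cancel_left _ _ hKdet]
  · rw [mul_nonsing_inv_cancel_left _ _ hKdet]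
  · rw [key, mul_nonsing_inv_cancel_left _ _ hLdet, hM₁₂]
    have : P * B + ρ • (Fᵀ * P * G) + Cᵀ * D - ρ • (Fᵀ * P * G) - Cᵀ * D = P * B := by abel
    rw [this, nonsing_inv_mul_cancel_left _ _ hPdet]
  · have hLT : IsUnit (Lᵀ).det := by rwa [det_transpose]
    have h := schur_aux (-M₁₁) L M₁₂ ((Lᵀ)⁻¹ * (L⁻¹ * M₁₂)) (L⁻¹ * M₁₂) M₂₂ hL
      (mul_nonsing_inv_cancel_left _ _ hLdet) (mul_nonsing_inv_cancel_left _ _ hLT)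
      (by rwa [neg_neg])
    rw [key]
    convert h using 1
    rw [hM₂₂]
    abel
end

section
/- Let n, ℓ, q be positive integers, let γ > 0 and ρ ∈ [-1, 1] be real numbers, let P and Q be n×n real positive definite matrices, let S be a skew-symmetric n×n real matrix, let F̃ ∈ ℝ^{n×n}, B̃, G̃ ∈ ℝ^{n×ℓ}, C ∈ ℝ^{q×n}, D ∈ ℝ^{q×ℓ}, and let L_{P⁻¹} and L_Q be lower-triangular matrices with positive diagonals satisfying L_{P⁻¹} * L_{P⁻¹}ᵀ = P⁻¹ and L_Q * L_Qᵀ = Q. Assume γ² • I - (B̃ᵀ*B̃ + Dᵀ*D + G̃ᵀ*G̃) is positive definite. Define A := -(1/2) * P⁻¹ * (Q + F̃ᵀ*F̃ + Cᵀ*C + S), F := L_{P⁻¹} * F̃, G := L_{P⁻¹} * G̃, and B := P⁻¹ * (L_Q * B̃ - ρ • (F̃ᵀ * G̃) - Cᵀ*D). Then the block matrix M := fromBlocks M₁₁ M₁₂ M₁₂ᵀ M₂₂, with M₁₁ = P*A + Aᵀ*P + Fᵀ*P*F + Cᵀ*C, M₁₂ = P*B + ρ • (Fᵀ*P*G) +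 Cᵀ*D, and M₂₂ = Dᵀ*D - γ² • I + Gᵀ*P*G, is negative definite. -/
open Matrix

/-- Converse of the BRL parametrization: any choice of free parameters
`P, Q, S, Ft, Bt, Gt, C, D` with `Btᵀ Bt + Dᵀ D + Gtᵀ Gt < γ² I` yields, through the
direct parametrization, SSM matrices whose bounded-real LMI matrix `M` is negative
definite. -/
theorem brl_param_converse {n ℓ q : ℕ} (hn : 0 < n) (hℓ : 0 < ℓ) (hq : 0 < q)
    (γ ρ : ℝ) (hγ : 0 < γ) (hρ : ρ ∈ Set.Icc (-1 : ℝ) 1)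
    (P Q : Matrix (Fin n) (Fin n) ℝ) (hP : P.PosDef) (hQ : Q.PosDef)
    (S : Matrix (Fin n) (Fin n) ℝ) (hS : Sᵀ = -S)
    (Ft : Matrix (Fin n) (Fin n) ℝ)
    (Bt Gt : Matrix (Fin n) (Fin ℓ) ℝ)
    (C : Matrix (Fin q) (Fin n) ℝ)
    (D : Matrix (Fin q) (Fin ℓ) ℝ)
    (LPinv LQ : Matrix (Fin n) (Fin n) ℝ)
    (hLPtri : ∀ i j, i < j → LPinv i j = 0) (hLPdiag : ∀ i, 0 < LPinv i i)
    (hLP : LPinv * LPinvᵀ = P⁻¹)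
    (hLQtri : ∀ i j, i < j → LQ i j = 0) (hLQdiag : ∀ i, 0 < LQ i i)
    (hLQ : LQ * LQᵀ = Q)
    (hcond : (γ ^ 2 • (1 : Matrix (Fin ℓ) (Fin ℓ) ℝ) -
      (Btᵀ * Bt + Dᵀ * D + Gtᵀ * Gt)).PosDef)
    (A F : Matrix (Fin n) (Fin n) ℝ)
    (B G : Matrix (Fin n) (Fin ℓ) ℝ)
    (hA : A = (-(1/2 : ℝ)) • (P⁻¹ * (Q + Ftᵀ * Ft + Cᵀ * C + S)))
    (hF : F = LPinv * Ft)
    (hG : G = LPinv * Gt)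
    (hB : B = P⁻¹ * (LQ * Bt - ρ • (Ftᵀ * Gt) - Cᵀ * D))
    (M₁₁ : Matrix (Fin n) (Fin n) ℝ)
    (M₁₂ : Matrix (Fin n) (Fin ℓ) ℝ)
    (M₂₂ : Matrix (Fin ℓ) (Fin ℓ) ℝ)
    (hM₁₁ : M₁₁ = P * A + Aᵀ * P + Fᵀ * P * F + Cᵀ * C)
    (hM₁₂ : M₁₂ = P * B + ρ • (Fᵀ * P * G) + Cᵀ * D)
    (hM₂₂ : M₂₂ = Dᵀ * D - γ ^ 2 • (1 : Matrix (Fin ℓ) (Fin ℓ) ℝ) + Gᵀ * P * G) :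
    (-(fromBlocks M₁₁ M₁₂ M₁₂ᵀ M₂₂)).PosDef := by
  have hPt : Pᵀ = P := by simpa [conjTranspose_eq_transpose_of_trivial] using hP.1.eq
  have hQt : Qᵀ = Q := by simpa [conjTranspose_eq_transpose_of_trivial] using hQ.1.eq
  have hdet : IsUnit P.det := (Matrix.isUnit_iff_isUnit_det P).1 hP.isUnit
  have hPP : P * P⁻¹ = 1 := Matrix.mul_nonsing_inv P hdet
  have hPP' : P⁻¹ * P = 1 := Matrix.nonsing_inv_mul P hdet
  have hPit : (P⁻¹)ᵀ = P⁻¹ := by rw [Matrix.transpose_nonsing_inv, hPt]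
  have hL : LPinvᵀ * (P * LPinv) = 1 := by
    apply mul_eq_one_comm.1
    rw [Matrix.mul_assoc, hLP, hPP]
  have key : ∀ {a b : ℕ} (X : Matrix (Fin n) (Fin a) ℝ) (Y : Matrix (Fin n) (Fin b) ℝ),
      (LPinv * X)ᵀ * P * (LPinv * Y) = Xᵀ * Y := by
    intro a b X Y
    calc (LPinv * X)ᵀ * P * (LPinv * Y) = Xᵀ * (LPinvᵀ * (P * LPinv)) * Y := by
          simp only [Matrix.transpose_mul, Matrix.mul_assoc]
      _ = _ := by rw [hL, Matrix.mul_one]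
  have h11 : M₁₁ = -Q := by
    have e1 : P * A = (-(1/2 : ℝ)) • (Q + Ftᵀ * Ft + Cᵀ * C + S) := by
      rw [hA, Matrix.mul_smul, ← Matrix.mul_assoc, hPP, Matrix.one_mul]
    have e2 : Aᵀ * P = (-(1/2 : ℝ)) • (Q + Ftᵀ * Ft + Cᵀ * C - S) := by
      have : Aᵀ * P = (P * A)ᵀ := by rw [Matrix.transpose_mul, hPt]
      rw [this, e1]
      simp [Matrix.transpose_mul, hQt, hS, sub_eq_add_neg]
    rw [hM₁₁, e1, e2, hF, key]
    module
  have h12 : M₁₂ = LQ * Bt := by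
    rw [hM₁₂, hB, hF, hG, key, ← Matrix.mul_assoc, hPP, Matrix.one_mul]
    abel
  set W := γ ^ 2 • (1 : Matrix (Fin ℓ) (Fin ℓ) ℝ) - (Btᵀ * Bt + Dᵀ * D + Gtᵀ * Gt) with hW
  have h22 : M₂₂ = -(W + Btᵀ * Bt) := by
    rw [hM₂₂, hG, key, hW]
    abel
  have hWt : Wᵀ = W := by simpa [conjTranspose_eq_transpose_of_trivial] using hcond.1.eq
  rw [h11, h12, h22]
  apply PosDef.of_dotProduct_mulVec_pos
  · rw [IsHermitian, conjTranspose_eq_transpose_of_trivial]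
    simp [fromBlocks_transpose, hQt, hWt]
  · intro x hx
    obtain ⟨u, v, rfl⟩ : ∃ u v, x = Sum.elim u v := ⟨_, _, (Sum.elim_comp_inl_inr x).symm⟩
    have hform : star (Sum.elim u v) ⬝ᵥ
        (-(fromBlocks (-Q) (LQ * Bt) (LQ * Bt)ᵀ (-(W + Btᵀ * Bt)))) *ᵥ (Sum.elim u v)
        = (LQᵀ *ᵥ u - Bt *ᵥ v) ⬝ᵥ (LQᵀ *ᵥ u - Bt *ᵥ v) + v ⬝ᵥ (W *ᵥ v) := by
      have a1 : u ⬝ᵥ (Q *ᵥ u) = (LQᵀ *ᵥ u) ⬝ᵥ (LQᵀ *ᵥ u) := by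
        rw [← hLQ, ← Matrix.mulVec_mulVec, Matrix.dotProduct_mulVec, Matrix.mulVec_transpose]
      have a2 : u ⬝ᵥ ((LQ * Bt) *ᵥ v) = (LQᵀ *ᵥ u) ⬝ᵥ (Bt *ᵥ v) := by
        rw [← Matrix.mulVec_mulVec, Matrix.dotProduct_mulVec, Matrix.mulVec_transpose]
      have a3 : v ⬝ᵥ ((LQ * Bt)ᵀ *ᵥ u) = (LQᵀ *ᵥ u) ⬝ᵥ (Bt *ᵥ v) := by
        rw [← a2, Matrix.mulVec_transpose, dotProduct_comm, ← Matrix.dotProduct_mulVec]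
      have a4 : v ⬝ᵥ ((Btᵀ * Bt) *ᵥ v) = (Bt *ᵥ v) ⬝ᵥ (Bt *ᵥ v) := by
        rw [← Matrix.mulVec_mulVec, Matrix.dotProduct_mulVec, Matrix.vecMul_transpose]
      have a5 := dotProduct_comm (Bt *ᵥ v) (LQᵀ *ᵥ u)
      rw [star_trivial, Matrix.neg_mulVec, fromBlocks_mulVec, dotProduct_neg]
      simp only [Sum.elim_comp_inl, Sum.elim_comp_inr, sumElim_dotProduct_sumElim,
        dotProduct_add, Matrix.neg_mulVec, dotProduct_neg, Matrix.add_mulVec, dotProduct_sub,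
        sub_dotProduct, a1, a2, a3, a4, a5]
      ring
    rw [hform]
    have hsq : 0 ≤ (LQᵀ *ᵥ u - Bt *ᵥ v) ⬝ᵥ (LQᵀ *ᵥ u - Bt *ᵥ v) :=
      Finset.sum_nonneg fun i _ => mul_self_nonneg _
    by_cases hv : v = 0
    · subst hv
      have hu : u ≠ 0 := by
        rintro rfl
        apply hx
        ext i
        cases i <;> rfl
      have h := hQ.dotProduct_mulVec_pos hu
      rw [star_trivial, ← hLQ, ← Matrix.mulVec_mulVec, Matrix.dotProduct_mulVec,
        ← Matrix.mulVec_transpose] at h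
      simpa using h
    · have h := hcond.dotProduct_mulVec_pos hv
      rw [star_trivial] at h
      linarith
end
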